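/- A lightcone framed curve (γ,ℓ⁺,ℓ⁻) : I → ℝ³₁ × Δ₄ with lightcone curvature (κ₁,κ₂,κ₃,α,β) is an (n,n̄ˢ)-Bertrand lightcone framed curve if and only if there exist smooth functions λ, θ : I → ℝ with λ ≢ 0 such that (α(t) + β(t) + λ(t)(κ₂(t)+κ₃(t)))·sinh θ(t) − (α(t) − β(t) + λ(t)(κ₂(t)−κ₃(t)))·cosh θ(t) = 0 for all t ∈ I. -/

import Mathlib

open Matrix

noncomputable section

/-- The Minkowski pseudo-scalar product on `ℝ³`:
`⟨x,y⟩ = −x₁y₁ + x₂y₂ + x₃y₃`. -/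
def mdot (x y : Fin 3 → ℝ) : ℝ := -(x 0 * y 0) + x 1 * y 1 + x 2 * y 2

/-- The pseudo vector product `x ∧ y` on Minkowski `ℝ³`, i.e. the determinant of the
matrix with rows `(−e₁, e₂, e₃)`, `x`, `y`. -/
def mcross (x y : Fin 3 → ℝ) : Fin 3 → ℝ :=
  ![-(x 1 * y 2 - x 2 * y 1), x 2 * y 0 - x 0 * y 2, x 0 * y 1 - x 1 * y 0]

/-- The (punctured) lightcone `LC* = {x ≠ 0 : ⟨x,x⟩ = 0}`. -/
def LCstar (x : Fin 3 → ℝ) : Prop := x ≠ 0 ∧ mdot x x = 0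

/-- Membership in `Δ₄ = {(v,w) ∈ LC* × LC* : ⟨v,w⟩ = −2}`. -/
def MemDelta4 (v w : Fin 3 → ℝ) : Prop := LCstar v ∧ LCstar w ∧ mdot v w = -2

/-- `n(t) = −(1/2) ℓ⁺(t) ∧ ℓ⁻(t)`. -/
def lcn (lp lm : ℝ → Fin 3 → ℝ) : ℝ → Fin 3 → ℝ :=
  fun t => (-(1/2) : ℝ) • mcross (lp t) (lm t)

/-- Smoothness (on `I`) of a real valued function. -/
def Smooth1 (I : Set ℝ) (f : ℝ → ℝ) : Prop := ContDiffOn ℝ (⊤ : ℕ∞) f I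

/-- Smoothness (on `I`) of an `ℝ³`-valued function. -/
def Smooth3 (I : Set ℝ) (f : ℝ → Fin 3 → ℝ) : Prop := ContDiffOn ℝ (⊤ : ℕ∞) f I

/-- `λ ≢ 0` : the set where `λ` is non-zero is dense in `I`. -/
def NotIdentZero (I : Set ℝ) (f : ℝ → ℝ) : Prop :=
  I ⊆ closure {t | t ∈ I ∧ f t ≠ 0}

/-- A lightcone framed curve `(γ, ℓ⁺, ℓ⁻) : I → ℝ³₁ × Δ₄`. -/
structure IsLightconeFramedCurve (I : Set ℝ) (γ lp lm : ℝ → Fin 3 → ℝ) : Prop where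
  smooth_base : Smooth3 I γ
  smooth_lp : Smooth3 I lp
  smooth_lm : Smooth3 I lm
  delta4 : ∀ t ∈ I, MemDelta4 (lp t) (lm t)
  exists_coeffs : ∃ α β : ℝ → ℝ, Smooth1 I α ∧ Smooth1 I β ∧
    ∀ t ∈ I, deriv γ t = α t • lp t + β t • lm t

/-- `(κ₁, κ₂, κ₃, α, β)` is the lightcone curvature of the lightcone framed curve
`(γ, ℓ⁺, ℓ⁻)`. -/
structure HasLightconeCurvature (I : Set ℝ) (γ lp lm : ℝ → Fin 3 → ℝ)
    (κ₁ κ₂ κ₃ α β : ℝ → ℝ) : Prop where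
  smooth_κ₁ : Smooth1 I κ₁
  smooth_κ₂ : Smooth1 I κ₂
  smooth_κ₃ : Smooth1 I κ₃
  smooth_α : Smooth1 I α
  smooth_β : Smooth1 I β
  deriv_lp : ∀ t ∈ I, deriv lp t = κ₁ t • lp t + (2 * κ₃ t) • lcn lp lm t
  deriv_lm : ∀ t ∈ I, deriv lm t = (-κ₁ t) • lm t + (2 * κ₂ t) • lcn lp lm t
  deriv_n : ∀ t ∈ I, deriv (lcn lp lm) t = κ₂ t • lp t + κ₃ t • lm t
  deriv_base : ∀ t ∈ I, deriv γ t = α t • lp t + β t • lm t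

/-- The vector field `ℓ⁺` built from a lightcone frame. -/
def fieldLp (lp lm : ℝ → Fin 3 → ℝ) : ℝ → Fin 3 → ℝ := fun t => lp t
/-- The vector field `ℓ⁻` built from a lightcone frame. -/
def fieldLm (lp lm : ℝ → Fin 3 → ℝ) : ℝ → Fin 3 → ℝ := fun t => lm t
/-- `nᵀ = (ℓ⁺ + ℓ⁻)/2`. -/
def fieldNT (lp lm : ℝ → Fin 3 → ℝ) : ℝ → Fin 3 → ℝ := fun t => (1/2 : ℝ) • (lp t + lm t)
/-- `nˢ = (ℓ⁺ − ℓ⁻)/2`. -/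
def fieldNS (lp lm : ℝ → Fin 3 → ℝ) : ℝ → Fin 3 → ℝ := fun t => (1/2 : ℝ) • (lp t - lm t)
/-- `n = −(1/2) ℓ⁺ ∧ ℓ⁻`. -/
def fieldN (lp lm : ℝ → Fin 3 → ℝ) : ℝ → Fin 3 → ℝ := lcn lp lm
/-- `ℓ̃⁺ = nᵀ + n`. -/
def fieldLtp (lp lm : ℝ → Fin 3 → ℝ) : ℝ → Fin 3 → ℝ :=
  fun t => fieldNT lp lm t + fieldN lp lm t
/-- `ℓ̃⁻ = nᵀ − n`. -/
def fieldLtm (lp lm : ℝ → Fin 3 → ℝ) : ℝ → Fin 3 → ℝ :=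
  fun t => fieldNT lp lm t - fieldN lp lm t

/-- `(γ,ℓ⁺,ℓ⁻)` and `(γ̄,ℓ̄⁺,ℓ̄⁻)` are `(v,w̄)`-mates. -/
def AreMates (I : Set ℝ)
    (v w : (ℝ → Fin 3 → ℝ) → (ℝ → Fin 3 → ℝ) → ℝ → Fin 3 → ℝ)
    (γ lp lm γ' lp' lm' : ℝ → Fin 3 → ℝ) : Prop :=
  IsLightconeFramedCurve I γ lp lm ∧ IsLightconeFramedCurve I γ' lp' lm' ∧
  ∃ lam : ℝ → ℝ, Smooth1 I lam ∧ NotIdentZero I lam ∧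
    (∀ t ∈ I, γ' t = γ t + lam t • v lp lm t) ∧
    (∀ t ∈ I, v lp lm t = w lp' lm' t)

/-- `(γ,ℓ⁺,ℓ⁻)` is a `(v,w̄)`-Bertrand lightcone framed curve. -/
def IsBertrand (I : Set ℝ)
    (v w : (ℝ → Fin 3 → ℝ) → (ℝ → Fin 3 → ℝ) → ℝ → Fin 3 → ℝ)
    (γ lp lm : ℝ → Fin 3 → ℝ) : Prop :=
  ∃ γ' lp' lm' : ℝ → Fin 3 → ℝ, AreMates I v w γ lp lm γ' lp' lm'

lemma mdot_comm (x y : Fin 3 → ℝ) : mdot x y = mdot y x := by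
  simp only [mdot]; ring

lemma mdot_add_left (x y z : Fin 3 → ℝ) : mdot (x + y) z = mdot x z + mdot y z := by
  simp only [mdot, Pi.add_apply]; ring

lemma mdot_smul_left (c : ℝ) (x z : Fin 3 → ℝ) : mdot (c • x) z = c * mdot x z := by
  simp only [mdot, Pi.smul_apply, smul_eq_mul]; ring

lemma mdot_add_right (x y z : Fin 3 → ℝ) : mdot z (x + y) = mdot z x + mdot z y := by
  simp only [mdot, Pi.add_apply]; ring

lemma mdot_smul_right (c : ℝ) (x z : Fin 3 → ℝ) : mdot z (c • x) = c * mdot z x := by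
  simp only [mdot, Pi.smul_apply, smul_eq_mul]; ring

lemma mdot_sub_left (x y z : Fin 3 → ℝ) : mdot (x - y) z = mdot x z - mdot y z := by
  simp only [mdot, Pi.sub_apply]; ring

lemma mdot_sub_right (x y z : Fin 3 → ℝ) : mdot z (x - y) = mdot z x - mdot z y := by
  simp only [mdot, Pi.sub_apply]; ring

lemma mdot_lcn_lp (lp lm : ℝ → Fin 3 → ℝ) (t : ℝ) : mdot (lcn lp lm t) (lp t) = 0 := by
  simp [mdot, lcn, mcross]; ring

lemma mdot_lcn_lm (lp lm : ℝ → Fin 3 → ℝ) (t : ℝ) : mdot (lcn lp lm t) (lm t) = 0 := by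
  simp [mdot, lcn, mcross]; ring

/-- The squared pseudo triple product is minus the Gram determinant. -/
lemma mdot_mcross_sq (x u v : Fin 3 → ℝ) :
    mdot x (mcross u v) ^ 2 =
      -(mdot x x * (mdot u u * mdot v v - mdot u v ^ 2)
        - mdot x u * (mdot x u * mdot v v - mdot u v * mdot x v)
        + mdot x v * (mdot x u * mdot u v - mdot u u * mdot x v)) := by
  simp [mdot, mcross]; ring

lemma mdot_mcross_self (u v : Fin 3 → ℝ) :
    mdot (mcross u v) (mcross u v) = mdot u v ^ 2 - mdot u u * mdot v v := by
  simp [mdot, mcross]; ring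

lemma mdot_lcn_self {lp lm : ℝ → Fin 3 → ℝ} {t : ℝ} (h : MemDelta4 (lp t) (lm t)) :
    mdot (lcn lp lm t) (lcn lp lm t) = 1 := by
  obtain ⟨⟨-, hp⟩, ⟨-, hm⟩, hpm⟩ := h
  simp only [lcn, mdot_smul_left, mdot_smul_right, mdot_mcross_self, hp, hm, hpm]
  norm_num

lemma mdot_self_eq {lp lm : ℝ → Fin 3 → ℝ} {t : ℝ} (h : MemDelta4 (lp t) (lm t))
    (x : Fin 3 → ℝ) :
    mdot x x = mdot x (lcn lp lm t) ^ 2 - mdot x (lp t) * mdot x (lm t) := by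
  obtain ⟨⟨-, hp⟩, ⟨-, hm⟩, hpm⟩ := h
  have := mdot_mcross_sq x (lp t) (lm t)
  simp only [hp, hm, hpm] at this
  simp only [lcn, mdot_smul_right, mul_pow, this]
  ring

lemma memDelta4_of_mdot {v w : Fin 3 → ℝ} (hv : mdot v v = 0) (hw : mdot w w = 0)
    (hvw : mdot v w = -2) : MemDelta4 v w := by
  refine ⟨⟨?_, hv⟩, ⟨?_, hw⟩, hvw⟩ <;> rintro rfl <;> simp [mdot] at hvw

/-- The hyperbolic condition in terms of the coefficients along `ℓ⁺` and `ℓ⁻`. -/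
lemma sinh_cosh_eq (A B θ : ℝ) :
    (A + B) * Real.sinh θ - (A - B) * Real.cosh θ = B * Real.exp θ - A * Real.exp (-θ) := by
  rw [Real.sinh_eq, Real.cosh_eq]; ring

lemma smooth1_mdot {I : Set ℝ} {f g : ℝ → Fin 3 → ℝ} (hf : Smooth3 I f) (hg : Smooth3 I g) :
    Smooth1 I (fun t => mdot (f t) (g t)) := by
  have hf' := contDiffOn_pi.1 hf
  have hg' := contDiffOn_pi.1 hg
  exact ((((hf' 0).mul (hg' 0)).neg).add ((hf' 1).mul (hg' 1))).add ((hf' 2).mul (hg' 2))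

lemma smooth3_lcn {I : Set ℝ} {lp lm : ℝ → Fin 3 → ℝ} (hp : Smooth3 I lp)
    (hm : Smooth3 I lm) : Smooth3 I (lcn lp lm) := by
  have hp' := contDiffOn_pi.1 hp
  have hm' := contDiffOn_pi.1 hm
  refine contDiffOn_pi.2 fun i => contDiffOn_const.mul ?_
  fin_cases i
  · exact (((hp' 1).mul (hm' 2)).sub ((hp' 2).mul (hm' 1))).neg
  · exact ((hp' 2).mul (hm' 0)).sub ((hp' 0).mul (hm' 2))
  · exact ((hp' 0).mul (hm' 1)).sub ((hp' 1).mul (hm' 0))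

lemma Smooth1.differentiableAt {I : Set ℝ} (hI : IsOpen I) {f : ℝ → ℝ} (hf : Smooth1 I f)
    {t : ℝ} (ht : t ∈ I) : DifferentiableAt ℝ f t :=
  (hf.differentiableOn (by simp)).differentiableAt (hI.mem_nhds ht)

lemma Smooth3.differentiableAt {I : Set ℝ} (hI : IsOpen I) {f : ℝ → Fin 3 → ℝ}
    (hf : Smooth3 I f) {t : ℝ} (ht : t ∈ I) : DifferentiableAt ℝ f t :=
  (hf.differentiableOn (by simp)).differentiableAt (hI.mem_nhds ht)

/-- Velocity of the curve obtained by moving `γ` along `n`. -/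
lemma deriv_add_smul_lcn {I : Set ℝ} (hI : IsOpen I) {γ lp lm γ' : ℝ → Fin 3 → ℝ}
    {κ₁ κ₂ κ₃ α β lam : ℝ → ℝ} (hF : IsLightconeFramedCurve I γ lp lm)
    (hC : HasLightconeCurvature I γ lp lm κ₁ κ₂ κ₃ α β) (hlam : Smooth1 I lam)
    (h : ∀ t ∈ I, γ' t = γ t + lam t • lcn lp lm t) {t : ℝ} (ht : t ∈ I) :
    deriv γ' t = (α t + lam t * κ₂ t) • lp t + (β t + lam t * κ₃ t) • lm t
      + deriv lam t • lcn lp lm t := by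
  have hn := (smooth3_lcn hF.smooth_lp hF.smooth_lm).differentiableAt hI ht
  have hd := (hF.smooth_base.differentiableAt hI ht).hasDerivAt.add
    ((hlam.differentiableAt hI ht).hasDerivAt.smul hn.hasDerivAt)
  have he : γ' =ᶠ[nhds t] γ + lam • lcn lp lm := by
    filter_upwards [hI.mem_nhds ht] with s hs using h s hs
  rw [he.deriv_eq, hd.deriv, hC.deriv_base t ht, hC.deriv_n t ht]
  module

lemma exists_angle_of_mates {I : Set ℝ} (hI : IsOpen I) {γ lp lm γ' lp' lm' : ℝ → Fin 3 → ℝ}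
    {κ₁ κ₂ κ₃ α β lam : ℝ → ℝ} (hF : IsLightconeFramedCurve I γ lp lm)
    (hC : HasLightconeCurvature I γ lp lm κ₁ κ₂ κ₃ α β)
    (hF' : IsLightconeFramedCurve I γ' lp' lm') (hlam : Smooth1 I lam)
    (hγ : ∀ t ∈ I, γ' t = γ t + lam t • lcn lp lm t)
    (hn : ∀ t ∈ I, lcn lp lm t = fieldNS lp' lm' t) :
    ∃ θ : ℝ → ℝ, Smooth1 I θ ∧
      ∀ t ∈ I, (α t + β t + lam t * (κ₂ t + κ₃ t)) * Real.sinh (θ t) -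
        (α t - β t + lam t * (κ₂ t - κ₃ t)) * Real.cosh (θ t) = 0 := by
  obtain ⟨α', β', -, -, hγ'⟩ := hF'.exists_coeffs
  set p : ℝ → ℝ := fun t => mdot (fieldNT lp' lm' t) (lp t) with hp
  set q : ℝ → ℝ := fun t => mdot (fieldNT lp' lm' t) (lm t) with hq
  have hpq : ∀ t ∈ I, p t * q t = 1 := by
    intro t ht
    have h := mdot_self_eq (hF.delta4 t ht) (fieldNT lp' lm' t)
    obtain ⟨⟨-, hpp⟩, ⟨-, hmm⟩, hpm⟩ := hF'.delta4 t ht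
    have hmp := hpm
    rw [mdot_comm] at hmp
    rw [hn t ht] at h
    simp only [fieldNT, fieldNS, mdot_smul_left, mdot_smul_right, mdot_add_left, mdot_add_right,
      mdot_sub_right, hpp, hmm, hpm, hmp] at h
    simp only [hp, hq, fieldNT, mdot_smul_left, mdot_add_left]
    linarith
  have hNT : Smooth3 I (fieldNT lp' lm') :=
    (hF'.smooth_lp.add hF'.smooth_lm).const_smul (1 / 2 : ℝ)
  have hq0 : ∀ t ∈ I, q t ≠ 0 := fun t ht h0 => by simpa [h0] using hpq t ht
  refine ⟨fun t => Real.log (q t), (smooth1_mdot hNT hF.smooth_lm).log hq0, fun t ht => ?_⟩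
  obtain ⟨⟨-, hpp⟩, ⟨-, hmm⟩, hpm⟩ := hF.delta4 t ht
  have hmp := hpm
  rw [mdot_comm] at hmp
  have hv : (α t + lam t * κ₂ t) • lp t + (β t + lam t * κ₃ t) • lm t
      + deriv lam t • lcn lp lm t
      = (α' t + β' t) • fieldNT lp' lm' t + (α' t - β' t) • lcn lp lm t := by
    rw [← deriv_add_smul_lcn hI hF hC hlam hγ ht, hγ' t ht, hn t ht, fieldNT, fieldNS]
    module
  have hB := congrArg (mdot · (lp t)) hv
  have hA := congrArg (mdot · (lm t)) hv
  simp only [mdot_add_left, mdot_smul_left, mdot_lcn_lp, mdot_lcn_lm, hpp, hmm, hpm, hmp]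
    at hA hB
  change _ = (α' t + β' t) * q t + _ at hA
  change _ = (α' t + β' t) * p t + _ at hB
  have key := sinh_cosh_eq (α t + lam t * κ₂ t) (β t + lam t * κ₃ t) (Real.log (q t))
  have hinv : (q t)⁻¹ = p t := (eq_inv_of_mul_eq_one_left (hpq t ht)).symm
  rw [Real.exp_neg, Real.exp_log_eq_abs (hq0 t ht), ← abs_inv, hinv] at key
  have hz : (β t + lam t * κ₃ t) * |q t| - (α t + lam t * κ₂ t) * |p t| = 0 := by
    have hpqt := hpq t ht
    rcases lt_or_gt_of_ne (hq0 t ht) with h | h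
    · have h' : p t < 0 := by nlinarith
      rw [abs_of_neg h, abs_of_neg h']
      linear_combination (q t) / 2 * hB - (p t) / 2 * hA
    · have h' : 0 < p t := by nlinarith
      rw [abs_of_pos h, abs_of_pos h']
      linear_combination -(q t) / 2 * hB + (p t) / 2 * hA
  linear_combination key + hz

lemma isBertrand_of_angle {I : Set ℝ} (hI : IsOpen I) {γ lp lm : ℝ → Fin 3 → ℝ}
    {κ₁ κ₂ κ₃ α β lam θ : ℝ → ℝ} (hF : IsLightconeFramedCurve I γ lp lm)
    (hC : HasLightconeCurvature I γ lp lm κ₁ κ₂ κ₃ α β)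
    (hlam : Smooth1 I lam) (hθ : Smooth1 I θ) (hlam0 : NotIdentZero I lam)
    (h : ∀ t ∈ I, (α t + β t + lam t * (κ₂ t + κ₃ t)) * Real.sinh (θ t) -
      (α t - β t + lam t * (κ₂ t - κ₃ t)) * Real.cosh (θ t) = 0) :
    IsBertrand I fieldN fieldNS γ lp lm := by
  have hE : Smooth1 I (fun t => Real.exp (θ t)) := hθ.exp
  have hE' : Smooth1 I (fun t => Real.exp (-θ t)) := hθ.neg.exp
  have hn := smooth3_lcn hF.smooth_lp hF.smooth_lm
  set T : ℝ → Fin 3 → ℝ := fun t =>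
    (1 / 2 : ℝ) • (Real.exp (θ t) • lp t + Real.exp (-θ t) • lm t) with hT
  have hTs : Smooth3 I T :=
    ((hE.smul hF.smooth_lp).add (hE'.smul hF.smooth_lm)).const_smul (1 / 2 : ℝ)
  have hEE : ∀ t, Real.exp (θ t) * Real.exp (-θ t) = 1 := fun t => by
    rw [← Real.exp_add, add_neg_cancel, Real.exp_zero]
  have hγ : ∀ t ∈ I, (fun t => γ t + lam t • lcn lp lm t) t = γ t + lam t • lcn lp lm t :=
    fun t _ => rfl
  have hlam' : Smooth1 I (deriv lam) := hlam.deriv_of_isOpen hI (by simp)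
  refine ⟨fun t => γ t + lam t • lcn lp lm t, fun t => T t + lcn lp lm t,
    fun t => T t - lcn lp lm t, hF,
    ⟨hF.smooth_base.add (hlam.smul hn), hTs.add hn, hTs.sub hn, fun t ht => ?_, ?_⟩,
    lam, hlam, hlam0, fun t _ => rfl, fun t _ => ?_⟩
  · have hnn := mdot_lcn_self (hF.delta4 t ht)
    obtain ⟨⟨-, hpp⟩, ⟨-, hmm⟩, hpm⟩ := hF.delta4 t ht
    have hmp := hpm
    rw [mdot_comm] at hmp
    have hTT : mdot (T t) (T t) = -1 := by
      simp only [hT, mdot_add_left, mdot_smul_left, mdot_add_right, mdot_smul_right, hpp, hmm,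
        hpm, hmp]
      linear_combination -hEE t
    have hnT : mdot (lcn lp lm t) (T t) = 0 := by
      simp only [hT, mdot_add_right, mdot_smul_right, mdot_lcn_lp, mdot_lcn_lm]
      ring
    have hTn := hnT
    rw [mdot_comm] at hTn
    apply memDelta4_of_mdot <;>
      simp only [mdot_add_left, mdot_add_right, mdot_sub_left, mdot_sub_right, hTT, hnT, hTn,
        hnn] <;>
      norm_num
  · have hc : Smooth1 I (fun t => (α t + lam t * κ₂ t) * Real.exp (-θ t)) :=
      (hC.smooth_α.add (hlam.mul hC.smooth_κ₂)).mul hE'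
    refine ⟨fun t => (α t + lam t * κ₂ t) * Real.exp (-θ t) + deriv lam t / 2,
      fun t => (α t + lam t * κ₂ t) * Real.exp (-θ t) - deriv lam t / 2,
      hc.add (hlam'.div_const 2), hc.sub (hlam'.div_const 2), fun t ht => ?_⟩
    have key := sinh_cosh_eq (α t + lam t * κ₂ t) (β t + lam t * κ₃ t) (θ t)
    have hBA : (β t + lam t * κ₃ t) * Real.exp (θ t)
        = (α t + lam t * κ₂ t) * Real.exp (-θ t) := by
      linear_combination h t ht - key
    rw [deriv_add_smul_lcn hI hF hC hlam hγ ht]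
    ext i
    simp only [hT, Pi.add_apply, Pi.sub_apply, Pi.smul_apply, smul_eq_mul]
    linear_combination (-(α t + lam t * κ₂ t) * lp t i - (β t + lam t * κ₃ t) * lm t i) * hEE t
      + Real.exp (-θ t) * lm t i * hBA
  · simp only [fieldN, fieldNS]
    module

/-- `(n,n̄ˢ)`-Bertrand lightcone framed curves: existence condition. -/
theorem bertrand_n_nSbar
    (I : Set ℝ) (hIo : IsOpen I) (hIc : I.OrdConnected)
    (γ lp lm : ℝ → Fin 3 → ℝ) (κ₁ κ₂ κ₃ α β : ℝ → ℝ)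
    (hF : IsLightconeFramedCurve I γ lp lm)
    (hC : HasLightconeCurvature I γ lp lm κ₁ κ₂ κ₃ α β) :
    IsBertrand I fieldN fieldNS γ lp lm ↔
      ∃ lam θ : ℝ → ℝ, Smooth1 I lam ∧ Smooth1 I θ ∧ NotIdentZero I lam ∧
        ∀ t ∈ I, (α t + β t + lam t * (κ₂ t + κ₃ t)) * Real.sinh (θ t) -
          (α t - β t + lam t * (κ₂ t - κ₃ t)) * Real.cosh (θ t) = 0 := by
  constructor
  · rintro ⟨γ', lp', lm', -, hF', lam, hlam, hlam0, hγ, hn⟩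
    obtain ⟨θ, hθ, h⟩ := exists_angle_of_mates hIo hF hC hF' hlam hγ hn
    exact ⟨lam, θ, hlam, hθ, hlam0, h⟩
  · rintro ⟨lam, θ, hlam, hθ, hlam0, h⟩
    exact isBertrand_of_angle hIo hF hC hlam hθ hlam0 h
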